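/- Let k ≥ 1 and r ≥ 2 be integers, n ≥ kr(k+r−2) + 2r − 1, and let H be the r-uniform hypergraph consisting of exactly k pairwise disjoint edges. Then φ_H^r(K_n^r) = ⌊C(n,r)/k⌋ + (C(n,r) mod k), where K_n^r is the complete r-graph on n vertices. -/

import Mathlib

/-- `p` is a copy of the `r`-graph `H` consisting of exactly `k` pairwise disjoint edges:
a set of `k` pairwise disjoint edges. -/
def IsMatchingSet (k : ℕ) {n : ℕ} (p : Finset (Finset (Fin n))) : Prop :=
  p.card = k ∧ ∀ e ∈ p, ∀ f ∈ p, e ≠ f → Disjoint e f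

/-- A decomposition of the edge set `G` of an `r`-graph into parts `P`, where each part is
either a single edge or a copy of the `r`-graph `H` consisting of `k` pairwise disjoint
edges. -/
def IsMatchingDecomp (k : ℕ) {n : ℕ} (G : Finset (Finset (Fin n)))
    (P : Finset (Finset (Finset (Fin n)))) : Prop :=
  (∀ p ∈ P, ∀ q ∈ P, p ≠ q → Disjoint p q) ∧
    P.biUnion id = G ∧
    ∀ p ∈ P, (∃ e, p = {e}) ∨ IsMatchingSet k p

/-- `φ_H^r(G)`: the minimum number of parts in an `H`-decomposition of `G`, where `H`
consists of `k` pairwise disjoint edges. -/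
noncomputable def phiM (k : ℕ) {n : ℕ} (G : Finset (Finset (Fin n))) : ℕ :=
  sInf {m | ∃ P, IsMatchingDecomp k G P ∧ P.card = m}

/-- `φ_H^r(n)`: the maximum of `φ_H^r(G)` over all `r`-graphs `G` on `n` vertices. -/
noncomputable def phiMMax (r k n : ℕ) : ℕ :=
  sSup {m | ∃ G : Finset (Finset (Fin n)), (∀ e ∈ G, e.card = r) ∧ phiM k G = m}

open Finset in
/-- Among the `r`-sets with trace `S` on `L`, the vertex `v ∉ L` is covered with the average
frequency over all vertices outside `L`. -/
lemma card_compl_mul_card_trace_mem {V : Type*} [Fintype V] [DecidableEq V] (r : ℕ)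
    (L S : Finset V) (v : V) (hv : v ∉ L) :
    #Lᶜ * #{T ∈ powersetCard r (univ : Finset V) | T ∩ L = S ∧ v ∈ T} =
      #{T ∈ powersetCard r (univ : Finset V) | T ∩ L = S} * (r - #S) := by
  have hdeg : ∀ u ∈ Lᶜ, #{T ∈ powersetCard r (univ : Finset V) | T ∩ L = S ∧ u ∈ T} =
      #{T ∈ powersetCard r (univ : Finset V) | T ∩ L = S ∧ v ∈ T} := by
    intro u hu
    have hu : u ∉ L := by simpa using hu
    have hL : L.map (Equiv.swap u v).toEmbedding = L := by
      apply Finset.eq_of_subset_of_card_le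
      · intro x hx
        obtain ⟨y, hy, rfl⟩ := mem_map.1 hx
        have h1 : y ≠ u := by rintro rfl; exact hu hy
        have h2 : y ≠ v := by rintro rfl; exact hv hy
        simpa [Equiv.swap_apply_of_ne_of_ne h1 h2] using hy
      · simp
    have hS : ∀ T : Finset V, T.map (Equiv.swap u v).toEmbedding ∩ L = T ∩ L := by
      intro T
      ext x
      simp only [mem_inter, mem_map_equiv, Equiv.symm_swap]
      refine and_congr_left fun hx => ?_
      have h1 : x ≠ u := by rintro rfl; exact hu hx
      have h2 : x ≠ v := by rintro rfl; exact hv hx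
      rw [Equiv.swap_apply_of_ne_of_ne h1 h2]
    refine card_nbij' (fun T => T.map (Equiv.swap u v).toEmbedding)
      (fun T => T.map (Equiv.swap u v).toEmbedding) ?_ ?_ ?_ ?_
    · intro T hT
      simp_all [mem_powersetCard]
    · intro T hT
      simp_all [mem_powersetCard]
    · intro T _
      ext x
      simp
    · intro T _
      ext x
      simp
  calc _ = ∑ u ∈ Lᶜ, #{T ∈ powersetCard r (univ : Finset V) | T ∩ L = S ∧ u ∈ T} := by
        rw [sum_congr rfl hdeg, sum_const, smul_eq_mul]
    _ = ∑ u ∈ Lᶜ, #{T ∈ {T ∈ powersetCard r (univ : Finset V) | T ∩ L = S} | u ∈ T} := by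
        simp only [filter_filter]
    _ = ∑ T ∈ powersetCard r (univ : Finset V) with T ∩ L = S, #{u ∈ Lᶜ | u ∈ T} :=
        (sum_card_bipartiteAbove_eq_sum_card_bipartiteBelow (fun u T => u ∈ T))
    _ = _ := by
        rw [sum_const_nat]
        intro T hT
        simp only [mem_filter, mem_powersetCard] at hT
        have h1 : ({u ∈ Lᶜ | u ∈ T} : Finset V) = T \ L := by
          ext x; simp [and_comm]
        have h2 := card_sdiff_add_card_inter T L
        rw [hT.2] at h2
        rw [h1]
        omega

open Finset in
/-- If every class of `c` has weight at most `m` and, for each label `S`, the elements of `A`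
labelled `S` account for a fraction `1 / m` of the weight of the elements of `X` labelled `S`,
then `A` can be mapped to `X` preserving labels, hitting each class at most once and each class
of weight `m` exactly once. -/
lemma exists_class_representatives {X Q α β : Type*} [Fintype X] [Fintype Q] [DecidableEq Q]
    [DecidableEq α] [DecidableEq β]
    (c : X → Q) (f : X → β) (w : X → ℕ) (m : ℕ) (hm : 0 < m)
    (hw : ∀ i, ∑ x with c x = i, w x ≤ m) (A : Finset α) (t : α → β)
    (hA : ∀ S, m * #{T ∈ A | t T = S} = ∑ x with f x = S, w x) :
    ∃ g : A → X, Function.Injective (c ∘ g) ∧ (∀ T, f (g T) = t T) ∧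
      ∀ i, (∀ T, c (g T) ≠ i) → ∑ x with c x = i, w x < m := by
  have hfib : ∀ s : Finset β, m * #{T ∈ A | t T ∈ s} = ∑ x with f x ∈ s, w x := by
    intro s
    rw [card_eq_sum_card_fiberwise (f := t) (t := s) (by intro T hT; simp_all), mul_sum,
      ← sum_fiberwise_of_maps_to (g := f) (t := s) (by intro x hx; simp_all)]
    refine sum_congr rfl fun S hS => ?_
    rw [filter_filter, filter_filter]
    have h1 : ∀ T, (t T ∈ s ∧ t T = S) ↔ t T = S := by grind
    have h2 : ∀ x, (f x ∈ s ∧ f x = S) ↔ f x = S := by grind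
    simp only [h1, h2, hA]
  have htot : m * #A = ∑ i, ∑ x with c x = i, w x := by
    have h := hfib (A.image t ∪ univ.image f)
    rw [filter_true_of_mem, filter_true_of_mem] at h
    · rw [h, sum_fiberwise]
    · intro x _; simp
    · intro T hT; exact mem_union_left _ (mem_image_of_mem _ hT)
  have hAQ : #A ≤ Fintype.card Q := by
    refine Nat.le_of_mul_le_mul_left ?_ hm
    rw [htot]
    calc _ ≤ ∑ i : Q, m := sum_le_sum fun i _ => hw i
      _ = _ := by simp [mul_comm]
  let N : A ⊕ Fin (Fintype.card Q - #A) → Finset Q :=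
    Sum.elim (fun T => ({x | f x = t T} : Finset X).image c)
      (fun _ => ({i | ∑ x with c x = i, w x < m} : Finset Q))
  have hall : ∀ s : Finset (A ⊕ Fin (Fintype.card Q - #A)), #s ≤ #(s.biUnion N) := by
    intro s
    refine Nat.le_of_mul_le_mul_left ?_ hm
    have hl : m * #s.toLeft ≤
        ∑ i, ∑ x with c x = i, if f x ∈ s.toLeft.image (fun T : A => t T) then w x else 0 := by
      rw [sum_fiberwise, ← sum_filter, ← hfib]
      refine Nat.mul_le_mul_left _ ?_
      rw [← card_map (Function.Embedding.subtype _)]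
      refine card_le_card ?_
      intro T hT
      obtain ⟨T', hT', rfl⟩ := mem_map.1 hT
      simp only [mem_filter]
      exact ⟨T'.2, mem_image_of_mem (fun T : A => t T) hT'⟩
    have hr : m * #s.toRight ≤
        ∑ i, if s.toRight.Nonempty then m - ∑ x with c x = i, w x else 0 := by
      split_ifs with h
      · have h1 : #s.toRight ≤ Fintype.card Q - #A := by simpa using card_le_univ s.toRight
        have h2 : ∑ i, (m - ∑ x with c x = i, w x) + m * #A = m * Fintype.card Q := by
          rw [htot, ← sum_add_distrib, sum_congr rfl (fun i _ => Nat.sub_add_cancel (hw i))]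
          simp [mul_comm]
        have h3 := Nat.mul_le_mul_left m h1
        rw [Nat.mul_sub] at h3
        omega
      · simp_all
    calc m * #s = m * #s.toLeft + m * #s.toRight := by
          rw [← mul_add, card_toLeft_add_card_toRight]
      _ ≤ _ := add_le_add hl hr
      _ ≤ ∑ i, if i ∈ s.biUnion N then m else 0 := by
          rw [← sum_add_distrib]
          refine sum_le_sum fun i _ => ?_
          have hle : (∑ x with c x = i,
              if f x ∈ s.toLeft.image (fun T : A => t T) then w x else 0) ≤
              ∑ x with c x = i, w x :=
            sum_le_sum fun x _ => by split_ifs <;> simp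
          have := hw i
          split_ifs with h1 h2 h2
          · omega
          · have : ¬ ∑ x with c x = i, w x < m := by
              intro hlt
              obtain ⟨d, hd⟩ := h1
              exact h2 (mem_biUnion.2 ⟨Sum.inr d, mem_toRight.1 hd, by simpa [N] using hlt⟩)
            rw [sum_eq_zero]
            · omega
            · intro x hx
              rw [if_neg]
              intro hfx
              obtain ⟨T, hT, hTx⟩ := mem_image.1 hfx
              refine h2 (mem_biUnion.2 ⟨Sum.inl T, mem_toLeft.1 hT, ?_⟩)
              exact mem_image.2 ⟨x, by simpa using hTx.symm, by simpa using hx⟩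
          · omega
          · rw [sum_eq_zero]
            intro x hx
            rw [if_neg]
            intro hfx
            obtain ⟨T, hT, hTx⟩ := mem_image.1 hfx
            refine h2 (mem_biUnion.2 ⟨Sum.inl T, mem_toLeft.1 hT, ?_⟩)
            exact mem_image.2 ⟨x, by simpa using hTx.symm, by simpa using hx⟩
      _ = m * #(s.biUnion N) := by
          rw [← sum_filter, sum_const, smul_eq_mul, mul_comm, filter_univ_mem]
  obtain ⟨μ, hμ, hμN⟩ := (all_card_le_biUnion_card_iff_exists_injective N).1 hall
  have hμb : Function.Bijective μ := by
    rw [Fintype.bijective_iff_injective_and_card]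
    refine ⟨hμ, ?_⟩
    simp only [Fintype.card_sum, Fintype.card_coe, Fintype.card_fin]
    omega
  have hx : ∀ T : A, ∃ x, f x = t T ∧ c x = μ (Sum.inl T) := by
    intro T
    obtain ⟨x, hx, hc⟩ := mem_image.1 (hμN (Sum.inl T))
    exact ⟨x, by simpa using hx, hc⟩
  choose g hgf hgc using hx
  refine ⟨g, ?_, hgf, ?_⟩
  · intro T T' h
    simp only [Function.comp_apply, hgc] at h
    exact Sum.inl_injective (hμ h)
  · intro i hi
    obtain ⟨T | d, rfl⟩ := hμb.2 i
    · exact absurd (hgc T) (hi T)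
    · simpa [N] using hμN (Sum.inr d)

open Finset in
/-- **Baranyai's theorem**, for classes that are matchings, in terms of the traces of the edges
on a vertex set `L`. -/
lemma exists_disjoint_traces {V X Q : Type*} [Fintype V] [DecidableEq V] [Fintype X]
    [DecidableEq X] [Fintype Q] [DecidableEq Q] (r : ℕ) (c : X → Q)
    (hX : Fintype.card X = (Fintype.card V).choose r)
    (hc : ∀ i, #{x | c x = i} * r ≤ Fintype.card V) (L : Finset V) :
    ∃ f : X → Finset V,
      (∀ S, #{x | f x = S} = #{T ∈ powersetCard r (univ : Finset V) | T ∩ L = S}) ∧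
      (∀ x y, c x = c y → x ≠ y → Disjoint (f x) (f y)) ∧
      ∀ i, ∑ x with c x = i, (r - #(f x)) ≤ #Lᶜ := by
  induction L using Finset.induction_on with
  | empty =>
    refine ⟨fun _ => ∅, fun S => ?_, by simp, fun i => by simpa using hc i⟩
    by_cases hS : ∅ = S
    · subst hS
      simp [hX]
    · simp [hS]
  | insert v L hv ih =>
    obtain ⟨f, hf, hd, hw⟩ := ih
    have htr : ∀ x, ∃ T ∈ powersetCard r (univ : Finset V), T ∩ L = f x := by
      intro x
      have h : 0 < #{y | f y = f x} := card_pos.2 ⟨x, by simp⟩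
      rw [hf, card_pos] at h
      obtain ⟨T, hT⟩ := h
      exact ⟨T, (mem_filter.1 hT).1, (mem_filter.1 hT).2⟩
    have hvf : ∀ x, v ∉ f x := by
      intro x hx
      obtain ⟨T, -, hT⟩ := htr x
      rw [← hT] at hx
      exact hv (mem_inter.1 hx).2
    have hmL : #(insert v L)ᶜ + 1 = #Lᶜ := by
      rw [compl_insert, card_erase_add_one (by simpa using hv)]
    obtain ⟨g, hgc, hgf, hgi⟩ := exists_class_representatives c f (fun x => r - #(f x)) #Lᶜ
      (by omega) hw {T ∈ powersetCard r (univ : Finset V) | v ∈ T} (fun T => T ∩ L) (by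
        intro S
        rw [filter_filter, sum_congr rfl (g := fun _ => r - #S)
          (by intro x hx; simp [(mem_filter.1 hx).2]), sum_const, smul_eq_mul, hf,
          ← card_compl_mul_card_trace_mem r L S v hv]
        simp only [and_comm])
    have hginj : Function.Injective g := fun T T' h => hgc (congrArg c h)
    let C : Finset X := univ.image g
    have hlt : ∀ x ∈ C, #(f x) < r := by
      intro x hx
      obtain ⟨T, -, rfl⟩ := mem_image.1 hx
      obtain ⟨T, hT⟩ := T
      simp only [mem_filter, mem_powersetCard] at hT
      rw [hgf]
      refine lt_of_lt_of_eq (card_lt_card ?_) hT.1.2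
      exact ⟨inter_subset_left, fun h => hv (mem_inter.1 (h hT.2)).2⟩
    have hC : ∀ S, #{x ∈ C | f x = S} =
        #{T ∈ powersetCard r (univ : Finset V) | T ∩ L = S ∧ v ∈ T} := by
      intro S
      symm
      refine card_bij (fun T hT => g ⟨T, ?_⟩) ?_ ?_ ?_
      · simp only [mem_filter] at hT ⊢
        exact ⟨hT.1, hT.2.2⟩
      · intro T hT
        simp only [mem_filter] at hT
        simp [C, hgf, hT.2.1]
      · intro T hT T' hT' h
        simpa using hginj h
      · intro x hx
        simp only [mem_filter, C, mem_image] at hx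
        obtain ⟨⟨⟨T, hT⟩, -, rfl⟩, hx⟩ := hx
        rw [hgf] at hx
        simp only [mem_filter] at hT
        exact ⟨T, by simp only [mem_filter]; exact ⟨hT.1, hx, hT.2⟩, rfl⟩
    refine ⟨fun x => if x ∈ C then insert v (f x) else f x, ?_, ?_, ?_⟩
    · intro S
      dsimp only
      by_cases hvS : v ∈ S
      · have h1 : ({x | (if x ∈ C then insert v (f x) else f x) = S} : Finset X) =
            {x ∈ C | f x = S.erase v} := by
          ext x
          have := hvf x
          simp only [mem_filter, mem_univ, true_and]
          split_ifs with hx <;> simp only [hx, true_and, false_and]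
          · exact ⟨fun h => by rw [← h, erase_insert this],
              fun h => by rw [h, insert_erase hvS]⟩
          · simp only [iff_false]
            rintro rfl
            exact this hvS
        rw [h1, hC]
        congr 1
        refine filter_congr fun T _ => ?_
        constructor
        · rintro ⟨h, hvT⟩
          rw [inter_insert_of_mem hvT, h, insert_erase hvS]
        · intro h
          have hvT : v ∈ T := by rw [← h] at hvS; exact (mem_inter.1 hvS).1
          refine ⟨?_, hvT⟩
          rw [inter_insert_of_mem hvT] at h
          rw [← h, erase_insert]
          exact fun h => hv (mem_inter.1 h).2
      · have h1 : ({x | (if x ∈ C then insert v (f x) else f x) = S} : Finset X) =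
            ({x | f x = S} : Finset X) \ {x ∈ C | f x = S} := by
          ext x
          simp only [mem_filter, mem_univ, true_and, mem_sdiff]
          split_ifs with hx
          · simp only [hx, true_and, and_not_self, iff_false]
            rintro rfl
            exact hvS (mem_insert_self _ _)
          · simp [hx]
        have h2 : ({T ∈ powersetCard r (univ : Finset V) | T ∩ insert v L = S} :
            Finset (Finset V)) = {T ∈ powersetCard r (univ : Finset V) | T ∩ L = S} \
            {T ∈ powersetCard r (univ : Finset V) | T ∩ L = S ∧ v ∈ T} := by
          ext T
          simp only [mem_filter, mem_sdiff]
          by_cases hvT : v ∈ T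
          · have : T ∩ insert v L ≠ S := by
              rintro rfl
              exact hvS (by simp [hvT])
            simp only [this, hvT, and_true, and_false, false_iff]
            tauto
          · simp [hvT]
        rw [h1, h2, card_sdiff_of_subset, card_sdiff_of_subset, hf, hC]
        · intro T; simp only [mem_filter]; tauto
        · intro T; simp only [mem_filter, mem_univ]; tauto
    · intro x y hxy hne
      have hdxy := hd x y hxy hne
      have hx := hvf x
      have hy := hvf y
      have hnot : ¬ (x ∈ C ∧ y ∈ C) := by
        rintro ⟨h1, h2⟩
        obtain ⟨T, -, rfl⟩ := mem_image.1 h1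
        obtain ⟨T', -, rfl⟩ := mem_image.1 h2
        exact hne (congrArg g (hgc hxy))
      dsimp only
      split_ifs with h1 h2 h2
      · exact absurd ⟨h1, h2⟩ hnot
      · simp [hdxy, hy]
      · simp [hdxy, hx]
      · exact hdxy
    · intro i
      have hle : ∀ x, r - #(if x ∈ C then insert v (f x) else f x) ≤ r - #(f x) := by
        intro x
        split_ifs
        · rw [card_insert_of_notMem (hvf x)]; omega
        · exact le_rfl
      refine Nat.le_of_lt_succ ?_
      rw [Nat.succ_eq_add_one, hmL]
      by_cases hi : ∃ T, c (g T) = i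
      · obtain ⟨T, hT⟩ := hi
        refine lt_of_lt_of_le (sum_lt_sum (fun x _ => hle x) ⟨g T, by simp [hT], ?_⟩) (hw i)
        have hg : g T ∈ C := mem_image_of_mem _ (mem_univ _)
        have := hlt _ hg
        dsimp only
        rw [if_pos hg, card_insert_of_notMem (hvf _)]
        omega
      · push Not at hi
        exact lt_of_le_of_lt (sum_le_sum fun x _ => hle x) (hgi i hi)

open Finset in
/-- The edges of `K_n^r` can be partitioned into matchings of prescribed sizes. -/
lemma exists_matching_classes {V X Q : Type*} [Fintype V] [DecidableEq V] [Fintype X]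
    [DecidableEq X] [Fintype Q] [DecidableEq Q] (r : ℕ) (c : X → Q)
    (hX : Fintype.card X = (Fintype.card V).choose r)
    (hc : ∀ i, #{x | c x = i} * r ≤ Fintype.card V) :
    ∃ f : X → Finset V, Function.Injective f ∧
      univ.image f = powersetCard r (univ : Finset V) ∧
      ∀ x y, c x = c y → x ≠ y → Disjoint (f x) (f y) := by
  obtain ⟨f, hf, hd, -⟩ := exists_disjoint_traces r c hX hc univ
  simp only [inter_univ, filter_eq'] at hf
  have hinj : Function.Injective f := by
    intro x y hxy
    have h : #{z | f z = f y} ≤ 1 := by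
      rw [hf]
      split_ifs <;> simp
    exact card_le_one.1 h x (by simp [hxy]) y (by simp)
  refine ⟨f, hinj, eq_of_subset_of_card_le ?_ ?_, hd⟩
  · intro S hS
    obtain ⟨x, -, rfl⟩ := mem_image.1 hS
    have h : 0 < #{z | f z = f x} := card_pos.2 ⟨x, by simp⟩
    rw [hf] at h
    by_contra hS
    simp [hS] at h
  · rw [card_image_of_injective _ hinj, card_powersetCard, card_univ, card_univ, hX]

lemma IsMatchingDecomp.le_card {k n : ℕ} {G : Finset (Finset (Fin n))}
    {P : Finset (Finset (Finset (Fin n)))} (hk : 1 ≤ k) (h : IsMatchingDecomp k G P) :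
    G.card / k + G.card % k ≤ P.card := by
  classical
  obtain ⟨hd, hU, hp⟩ := h
  have hG : G.card = ∑ p ∈ P, p.card := by
    rw [← hU]
    exact Finset.card_biUnion hd
  have hsum : ∀ Q : Finset (Finset (Finset (Fin n))),
      (∀ p ∈ Q, p.card = 1 ∨ p.card = k) →
      ∃ a b, a + b = Q.card ∧ k * a + b = ∑ p ∈ Q, p.card := by
    intro Q
    induction Q using Finset.induction_on with
    | empty => exact fun _ => ⟨0, 0, by simp⟩
    | insert p Q hpQ ih =>
      intro hQ
      obtain ⟨a, b, h1, h2⟩ := ih fun q hq => hQ q (Finset.mem_insert_of_mem hq)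
      rw [Finset.card_insert_of_notMem hpQ, Finset.sum_insert hpQ]
      rcases hQ p (Finset.mem_insert_self _ _) with h | h
      · exact ⟨a, b + 1, by omega, by omega⟩
      · exact ⟨a + 1, b, by omega, by rw [mul_add]; omega⟩
  obtain ⟨a, b, h1, h2⟩ := hsum P fun p hpP => by
    rcases hp p hpP with ⟨e, rfl⟩ | h
    · simp
    · exact Or.inr h.1
  rw [hG, ← h2, ← h1, Nat.mul_add_div (by omega), Nat.mul_add_mod]
  have h3 := Nat.div_add_mod b k
  have h4 : b / k ≤ k * (b / k) := Nat.le_mul_of_pos_left _ hk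
  omega

/-- For `k ≥ 1`, `r ≥ 2`, `n ≥ kr(k+r-2) + 2r - 1`, and `H` the `r`-graph consisting of
exactly `k` pairwise disjoint edges, `φ_H^r(K_n^r) = ⌊C(n,r)/k⌋ + (C(n,r) mod k)`, where
`K_n^r` is the complete `r`-graph on `n` vertices. -/
theorem phiM_complete (k r n : ℕ) (hk : 1 ≤ k) (hr : 2 ≤ r)
    (hn : k * r * (k + r - 2) + 2 * r - 1 ≤ n) :
    phiM k (Finset.powersetCard r (Finset.univ : Finset (Fin n))) =
      n.choose r / k + n.choose r % k := by
  classical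
  have hkr : k * r ≤ n := by
    have : k * r ≤ k * r * (k + r - 2) := Nat.le_mul_of_pos_right _ (by omega)
    omega
  have hrn : r ≤ n := le_trans (Nat.le_mul_of_pos_left r hk) hkr
  set N := n.choose r with hN
  let c : (Fin (N / k) × Fin k) ⊕ Fin (N % k) → Fin (N / k) ⊕ Fin (N % k) :=
    Sum.map Prod.fst id
  have hinl : ∀ j, (Finset.univ.filter fun x => c x = Sum.inl j) =
      Finset.univ.image fun a => Sum.inl (j, a) := by
    intro j
    ext x
    rcases x with ⟨i, a⟩ | b <;> simp [c, eq_comm]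
  have hinr : ∀ j, (Finset.univ.filter fun x => c x = Sum.inr j) = {Sum.inr j} := by
    intro j
    ext x
    rcases x with ⟨i, a⟩ | b <;> simp [c]
  have hcl : ∀ j, (Finset.univ.filter fun x => c x = Sum.inl j).card = k := by
    intro j
    rw [hinl, Finset.card_image_of_injective, Finset.card_univ, Fintype.card_fin]
    intro a b h
    simpa using h
  obtain ⟨f, hinj, himg, hdis⟩ := exists_matching_classes (V := Fin n) r c
    (by simp [← hN, mul_comm, Nat.div_add_mod]) (by
      rintro (j | j)
      · simpa [hcl j] using hkr
      · simpa [hinr j] using hrn)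
  have hdecomp : IsMatchingDecomp k (Finset.powersetCard r (Finset.univ : Finset (Fin n)))
      (Finset.univ.image fun i => (Finset.univ.filter fun x => c x = i).image f) := by
    refine ⟨?_, ?_, ?_⟩
    · intro p hp q hq hpq
      obtain ⟨i, -, rfl⟩ := Finset.mem_image.1 hp
      obtain ⟨j, -, rfl⟩ := Finset.mem_image.1 hq
      rw [Finset.disjoint_image hinj, Finset.disjoint_filter]
      rintro x - rfl rfl
      exact hpq rfl
    · rw [← himg]
      ext e
      simp only [Finset.mem_biUnion, Finset.mem_image, Finset.mem_univ, true_and, id]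
      constructor
      · rintro ⟨-, ⟨i, rfl⟩, he⟩
        obtain ⟨x, -, rfl⟩ := Finset.mem_image.1 he
        exact ⟨x, rfl⟩
      · rintro ⟨x, rfl⟩
        exact ⟨_, ⟨c x, rfl⟩, Finset.mem_image_of_mem _ (by simp)⟩
    · intro p hp
      obtain ⟨i, -, rfl⟩ := Finset.mem_image.1 hp
      rcases i with j | j
      · right
        refine ⟨by rw [Finset.card_image_of_injective _ hinj, hcl], ?_⟩
        intro e he e' he' hne
        obtain ⟨x, hx, rfl⟩ := Finset.mem_image.1 he
        obtain ⟨y, hy, rfl⟩ := Finset.mem_image.1 he'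
        refine hdis x y ?_ (fun h => hne (congrArg f h))
        rw [(Finset.mem_filter.1 hx).2, (Finset.mem_filter.1 hy).2]
      · left
        exact ⟨f (Sum.inr j), by rw [hinr, Finset.image_singleton]⟩
  refine le_antisymm ?_ ?_
  · calc phiM k (Finset.powersetCard r (Finset.univ : Finset (Fin n)))
        ≤ _ := Nat.sInf_le ⟨_, hdecomp, rfl⟩
      _ ≤ _ := Finset.card_image_le
      _ = N / k + N % k := by simp
  · refine le_csInf ⟨_, _, hdecomp, rfl⟩ ?_
    rintro m ⟨P, hP, rfl⟩
    simpa [hN] using hP.le_card hk
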